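/- Let (Ω, 𝓕, P) be a probability space, let F : Ω → ℝ be a random variable with E|F| < ∞, and let γ denote the standard normal distribution N(0,1) on ℝ. Then the total variation distance between the law of F and γ satisfies: sup over Borel sets B ⊆ ℝ of |P(F ∈ B) − γ(B)| is at most the supremum, over all continuously differentiable functions f : ℝ → ℝ with ‖f‖_∞ ≤ √(π/2) and ‖f′‖_∞ ≤ 2, of |E[f′(F)] − E[F·f(F)]|. -/

import Mathlib

open MeasureTheory ProbabilityTheory

/-- The unnormalized standard Gaussian density. -/
noncomputable def gaussianWeight (t : ℝ) : ℝ := Real.exp (-(1 / 2) * t ^ 2)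

lemma gaussianWeight_pos (t : ℝ) : 0 < gaussianWeight t := Real.exp_pos _

lemma continuous_gaussianWeight : Continuous gaussianWeight := by
  unfold gaussianWeight
  fun_prop

lemma integrable_gaussianWeight : Integrable gaussianWeight :=
  integrable_exp_neg_mul_sq (by norm_num)

lemma gaussianWeight_abs (t : ℝ) : gaussianWeight |t| = gaussianWeight t := by
  simp [gaussianWeight]

lemma gaussianWeight_neg (t : ℝ) : gaussianWeight (-t) = gaussianWeight t := by
  simp [gaussianWeight]

lemma hasDerivAt_inv_gaussianWeight (x : ℝ) :
    HasDerivAt (fun y => (gaussianWeight y)⁻¹) (x * (gaussianWeight x)⁻¹) x := by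
  have h : (fun y => (gaussianWeight y)⁻¹) = fun y => Real.exp ((1 / 2) * y ^ 2) := by
    funext y
    rw [gaussianWeight, ← Real.exp_neg]
    ring_nf
  rw [show (gaussianWeight x)⁻¹ = Real.exp ((1 / 2) * x ^ 2) from congrFun h x, h]
  convert ((hasDerivAt_pow 2 x).const_mul (1 / 2 : ℝ)).exp using 1
  push_cast
  ring

lemma setIntegral_Ioi_gaussianWeight_eq (x : ℝ) :
    ∫ t in Set.Ioi x, gaussianWeight t = ∫ s in Set.Ioi 0, gaussianWeight (s + x) := by
  have h := (measurePreserving_add_right (volume : Measure ℝ) x).setIntegral_preimage_emb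
    (MeasurableEquiv.addRight x).measurableEmbedding gaussianWeight (Set.Ioi x)
  rw [← h]
  simp

lemma integrable_gaussianWeight_add (x : ℝ) : Integrable fun s => gaussianWeight (s + x) :=
  integrable_gaussianWeight.comp_add_right x

/-- The Gaussian tail is at most half of the total mass times the density. -/
lemma setIntegral_Ioi_gaussianWeight_le {x : ℝ} (hx : 0 ≤ x) :
    ∫ t in Set.Ioi x, gaussianWeight t ≤ √(Real.pi / 2) * gaussianWeight x := by
  have hhalf : ∫ s in Set.Ioi 0, gaussianWeight s = √(Real.pi / 2) := by
    have h := integral_gaussian_Ioi (1 / 2)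
    unfold gaussianWeight
    rw [h, show Real.pi / (1 / 2) = 2 ^ 2 * (Real.pi / 2) by ring,
      Real.sqrt_mul (by norm_num), Real.sqrt_sq (by norm_num)]
    ring
  rw [setIntegral_Ioi_gaussianWeight_eq, ← hhalf, ← integral_mul_const]
  refine setIntegral_mono_on (integrable_gaussianWeight_add x).integrableOn
    (integrable_gaussianWeight.mul_const _).integrableOn measurableSet_Ioi fun s hs => ?_
  have hs : 0 < s := hs
  unfold gaussianWeight
  rw [← Real.exp_add]
  gcongr
  nlinarith [mul_nonneg hx hs.le]

/-- Mills' bound for the Gaussian tail. -/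
lemma mul_setIntegral_Ioi_gaussianWeight_le {x : ℝ} (hx : 0 ≤ x) :
    x * ∫ t in Set.Ioi x, gaussianWeight t ≤ gaussianWeight x := by
  rcases hx.eq_or_lt with rfl | hx
  · simpa using (gaussianWeight_pos 0).le
  have hint : IntegrableOn (fun s => Real.exp (-x * s)) (Set.Ioi 0) :=
    integrableOn_exp_mul_Ioi (by linarith) 0
  have hle : ∫ t in Set.Ioi x, gaussianWeight t ≤
      ∫ s in Set.Ioi 0, Real.exp (-x * s) * gaussianWeight x := by
    rw [setIntegral_Ioi_gaussianWeight_eq]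
    refine setIntegral_mono_on (integrable_gaussianWeight_add x).integrableOn
      (hint.mul_const _) measurableSet_Ioi fun s _ => ?_
    unfold gaussianWeight
    rw [← Real.exp_add]
    gcongr
    nlinarith [sq_nonneg s]
  rw [integral_mul_const, integral_exp_mul_Ioi (by linarith)] at hle
  calc x * ∫ t in Set.Ioi x, gaussianWeight t
      ≤ x * (-Real.exp (-x * 0) / -x * gaussianWeight x) := by gcongr
    _ = gaussianWeight x := by
      simp
      field_simp

/-- The bounded primitive of a centred function dominated by the Gaussian density is dominated by
the Gaussian tail. -/
lemma abs_setIntegral_Iic_le {g : ℝ → ℝ} (hg : Integrable g)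
    (hle : ∀ t, |g t| ≤ gaussianWeight t) (hzero : ∫ t, g t = 0) (x : ℝ) :
    |∫ t in Set.Iic x, g t| ≤ ∫ t in Set.Ioi |x|, gaussianWeight t := by
  have hbound (s : Set ℝ) : |∫ t in s, g t| ≤ ∫ t in s, gaussianWeight t := by
    rw [← Real.norm_eq_abs]
    exact norm_integral_le_of_norm_le integrable_gaussianWeight.integrableOn (ae_of_all _ hle)
  rcases le_total 0 x with hx | hx
  · have hsplit := intervalIntegral.integral_Iic_add_Ioi (b := x) hg.integrableOn hg.integrableOn
    rw [hzero] at hsplit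
    rw [eq_neg_of_add_eq_zero_left hsplit, abs_neg, abs_of_nonneg hx]
    exact hbound _
  · rw [abs_of_nonpos hx, ← integral_comp_neg_Iic]
    simpa only [gaussianWeight_neg] using hbound (Set.Iic x)

lemma hasDerivAt_setIntegral_Iic {g : ℝ → ℝ} (hg : Integrable g) (hc : Continuous g) (x : ℝ) :
    HasDerivAt (fun y => ∫ t in Set.Iic y, g t) (g x) x := by
  have h : (fun y => ∫ t in Set.Iic y, g t) =
      fun y => (∫ t in Set.Iic 0, g t) + ∫ t in (0 : ℝ)..y, g t := by
    funext y
    rw [← intervalIntegral.integral_Iic_sub_Iic hg.integrableOn hg.integrableOn]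
    ring
  rw [h]
  exact (hc.integral_hasStrictDerivAt 0 x).hasDerivAt.const_add _

/-- Stein's equation `f' x - x f x = h x - E h` has a bounded continuously differentiable solution
with bounded derivative. -/
lemma exists_stein_solution {h : ℝ → ℝ} (hc : Continuous h) (h0 : ∀ x, 0 ≤ h x)
    (h1 : ∀ x, h x ≤ 1) :
    ∃ f : ℝ → ℝ, ContDiff ℝ 1 f ∧ (∀ y, |f y| ≤ √(Real.pi / 2)) ∧ (∀ y, |deriv f y| ≤ 2) ∧
      ∀ y, deriv f y - y * f y = h y - ∫ t, h t ∂(gaussianReal 0 1) := by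
  have hint : Integrable h (gaussianReal 0 1) :=
    Integrable.of_bound hc.aestronglyMeasurable 1
      (ae_of_all _ fun x => by rw [Real.norm_eq_abs, abs_of_nonneg (h0 x)]; exact h1 x)
  set c := ∫ t, h t ∂(gaussianReal 0 1) with hcdef
  have hc0 : 0 ≤ c := integral_nonneg h0
  have hc1 : c ≤ 1 := by
    simpa using integral_mono hint (integrable_const (1 : ℝ)) h1
  have habs (x : ℝ) : |h x - c| ≤ 1 :=
    abs_le.2 ⟨by linarith [h0 x], by linarith [h1 x]⟩
  let g : ℝ → ℝ := fun t => (h t - c) * gaussianWeight t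
  have hgc : Continuous g := (hc.sub continuous_const).mul continuous_gaussianWeight
  have hgle (t : ℝ) : |g t| ≤ gaussianWeight t := by
    rw [abs_mul, abs_of_pos (gaussianWeight_pos t)]
    exact mul_le_of_le_one_left (gaussianWeight_pos t).le (habs t)
  have hgint : Integrable g :=
    integrable_gaussianWeight.mono' hgc.aestronglyMeasurable (ae_of_all _ hgle)
  have hgzero : ∫ t, g t = 0 := by
    have hmean : ∫ t, (h t - c) ∂(gaussianReal 0 1) = 0 := by
      rw [integral_sub hint (integrable_const _)]
      simp [hcdef]
    rw [integral_gaussianReal_eq_integral_smul one_ne_zero] at hmean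
    have hpdf : ∀ t, gaussianPDFReal 0 1 t • (h t - c) = (√(2 * Real.pi))⁻¹ * g t := by
      intro t
      simp only [gaussianPDFReal, g, gaussianWeight, smul_eq_mul, NNReal.coe_one, mul_one, sub_zero]
      ring_nf
    rw [integral_congr_ae (ae_of_all _ hpdf), integral_const_mul] at hmean
    exact (mul_eq_zero.1 hmean).resolve_left (by positivity)
  let f : ℝ → ℝ := fun x => (gaussianWeight x)⁻¹ * ∫ t in Set.Iic x, g t
  have hderiv (x : ℝ) : HasDerivAt f (x * f x + (h x - c)) x := by
    have hmul := (hasDerivAt_inv_gaussianWeight x).mul (hasDerivAt_setIntegral_Iic hgint hgc x)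
    refine hmul.congr_deriv ?_
    have := (gaussianWeight_pos x).ne'
    simp only [f, g]
    field_simp
  have hfabs (x : ℝ) : |f x| ≤ (gaussianWeight |x|)⁻¹ * ∫ t in Set.Ioi |x|, gaussianWeight t := by
    have hpos := gaussianWeight_pos x
    rw [abs_mul, abs_of_pos (inv_pos.2 hpos), gaussianWeight_abs]
    gcongr
    exact abs_setIntegral_Iic_le hgint hgle hgzero x
  have hfle (x : ℝ) : |f x| ≤ √(Real.pi / 2) := by
    refine (hfabs x).trans ?_
    rw [inv_mul_le_iff₀ (gaussianWeight_pos _), mul_comm]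
    exact setIntegral_Ioi_gaussianWeight_le (abs_nonneg x)
  have hxfle (x : ℝ) : |x * f x| ≤ 1 := by
    rw [abs_mul]
    refine (mul_le_mul_of_nonneg_left (hfabs x) (abs_nonneg x)).trans ?_
    rw [mul_left_comm, inv_mul_le_iff₀ (gaussianWeight_pos _), mul_one]
    exact mul_setIntegral_Ioi_gaussianWeight_le (abs_nonneg x)
  have hd (x : ℝ) : deriv f x = x * f x + (h x - c) := (hderiv x).deriv
  have hfdiff : Differentiable ℝ f := fun x => (hderiv x).differentiableAt
  refine ⟨f, contDiff_one_iff_deriv.2 ⟨hfdiff, ?_⟩, hfle, fun y => ?_, fun y => ?_⟩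
  · rw [funext hd]
    exact (continuous_id.mul hfdiff.continuous).add (hc.sub continuous_const)
  · rw [hd]
    exact (abs_add_le _ _).trans (by linarith [hxfle y, habs y])
  · rw [hd]
    ring

/-- A Borel set is approximated in `L¹` of a finite measure by continuous functions with values in
the unit interval. -/
lemma exists_continuous_unitInterval_integral_sub_indicator_le (ν : Measure ℝ) [IsFiniteMeasure ν]
    {B : Set ℝ} (hB : MeasurableSet B) {ε : ℝ} (hε : 0 < ε) :
    ∃ h : ℝ → ℝ, Continuous h ∧ (∀ x, 0 ≤ h x) ∧ (∀ x, h x ≤ 1) ∧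
      ∫ x, |B.indicator 1 x - h x| ∂ν ≤ ε := by
  have hBint : Integrable (B.indicator (1 : ℝ → ℝ)) ν := (integrable_const 1).indicator hB
  obtain ⟨g, -, hgε, hgc, hgint⟩ := hBint.exists_hasCompactSupport_integral_sub_le hε
  refine ⟨fun x => max 0 (min 1 (g x)), by fun_prop, fun x => le_max_left _ _,
    fun x => max_le zero_le_one (min_le_left _ _), le_trans ?_ hgε⟩
  refine integral_mono_of_nonneg (ae_of_all _ fun x => abs_nonneg _) (hBint.sub hgint).norm
    (ae_of_all _ fun x => ?_)
  have hfix : B.indicator (1 : ℝ → ℝ) x = max 0 (min 1 (B.indicator 1 x)) := by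
    by_cases hx : x ∈ B <;> simp [hx]
  dsimp only
  rw [Real.norm_eq_abs]
  nth_rw 1 [hfix]
  refine (abs_max_sub_max_le_max _ _ _ _).trans (max_le (by simp) ?_)
  exact (abs_min_sub_min_le_max _ _ _ _).trans (max_le (by simp) le_rfl)

/-- Stein's bound (Theorem 2.1): for an integrable random variable `F` and the
standard normal distribution `γ = N(0,1)`, for every Borel set `B`,
`|P(F ∈ B) − γ(B)|` is bounded by the supremum over continuously differentiable
functions `f` with `‖f‖_∞ ≤ √(π/2)` and `‖f'‖_∞ ≤ 2` of `|E[f'(F)] − E[F·f(F)]|`. -/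
theorem stein_total_variation_bound
    (Ω : Type*) [MeasureSpace Ω] [IsProbabilityMeasure (ℙ : Measure Ω)]
    (F : Ω → ℝ) (hFmeas : Measurable F) (hFint : Integrable F ℙ) :
    ∀ B : Set ℝ, MeasurableSet B →
      |(ℙ (F ⁻¹' B)).toReal - ((gaussianReal 0 1) B).toReal| ≤
        sSup { x : ℝ | ∃ f : ℝ → ℝ, ContDiff ℝ 1 f ∧
          (∀ y : ℝ, |f y| ≤ Real.sqrt (Real.pi / 2)) ∧
          (∀ y : ℝ, |deriv f y| ≤ 2) ∧
          x = |(∫ ω, deriv f (F ω) ∂ℙ) - ∫ ω, F ω * f (F ω) ∂ℙ| } := by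
  intro B hB
  set S : Set ℝ := { x : ℝ | ∃ f : ℝ → ℝ, ContDiff ℝ 1 f ∧
    (∀ y : ℝ, |f y| ≤ Real.sqrt (Real.pi / 2)) ∧ (∀ y : ℝ, |deriv f y| ≤ 2) ∧
    x = |(∫ ω, deriv f (F ω) ∂ℙ) - ∫ ω, F ω * f (F ω) ∂ℙ| }
  have hint {f : ℝ → ℝ} (hf : ContDiff ℝ 1 f) (hfb : ∀ y, |f y| ≤ √(Real.pi / 2))
      (hdb : ∀ y, |deriv f y| ≤ 2) : Integrable (fun ω => deriv f (F ω)) ℙ ∧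
        Integrable (fun ω => F ω * f (F ω)) ℙ :=
    ⟨Integrable.of_bound ((measurable_deriv f).comp hFmeas).aestronglyMeasurable 2
      (ae_of_all _ fun ω => hdb _),
      hFint.mul_bdd (c := √(Real.pi / 2))
        (hf.continuous.measurable.comp hFmeas).aestronglyMeasurable
        (ae_of_all _ fun ω => hfb _)⟩
  have hbdd : BddAbove S := by
    refine ⟨2 + ∫ ω, |F ω| * √(Real.pi / 2) ∂ℙ, ?_⟩
    rintro x ⟨f, hf, hfb, hdb, rfl⟩
    refine (abs_sub _ _).trans (add_le_add ?_ ?_)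
    · simpa using norm_integral_le_of_norm_le_const (μ := (ℙ : Measure Ω))
        (f := fun ω => deriv f (F ω)) (ae_of_all _ fun ω => hdb (F ω))
    · rw [← Real.norm_eq_abs]
      refine norm_integral_le_of_norm_le (hFint.abs.mul_const _) (ae_of_all _ fun ω => ?_)
      rw [norm_mul, Real.norm_eq_abs, Real.norm_eq_abs]
      gcongr
      exact hfb _
  let μ : Measure ℝ := (ℙ : Measure Ω).map F
  have : IsProbabilityMeasure μ := Measure.isProbabilityMeasure_map hFmeas.aemeasurable
  let γ : Measure ℝ := gaussianReal 0 1
  have hcont {h : ℝ → ℝ} (hc : Continuous h) (h0 : ∀ x, 0 ≤ h x) (h1 : ∀ x, h x ≤ 1) :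
      |∫ x, h x ∂μ - ∫ x, h x ∂γ| ≤ sSup S := by
    obtain ⟨f, hf, hfb, hdb, heq⟩ := exists_stein_solution hc h0 h1
    refine le_csSup hbdd ⟨f, hf, hfb, hdb, ?_⟩
    obtain ⟨hi1, hi2⟩ := hint hf hfb hdb
    have hhF : Integrable (fun ω => h (F ω)) ℙ :=
      Integrable.of_bound (hc.measurable.comp hFmeas).aestronglyMeasurable 1
        (ae_of_all _ fun ω => by rw [Real.norm_eq_abs, abs_of_nonneg (h0 _)]; exact h1 _)
    rw [← integral_sub hi1 hi2]
    simp_rw [heq]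
    rw [integral_sub hhF (integrable_const _),
      integral_map hFmeas.aemeasurable hc.aestronglyMeasurable]
    simp [γ]
  refine le_of_forall_pos_le_add fun ε hε => ?_
  obtain ⟨h, hc, h0, h1, happrox⟩ :=
    exists_continuous_unitInterval_integral_sub_indicator_le (μ + γ) hB hε
  have hclose (ν : Measure ℝ) [IsProbabilityMeasure ν] :
      Integrable (fun x => |B.indicator 1 x - h x|) ν ∧
        |ν.real B - ∫ x, h x ∂ν| ≤ ∫ x, |B.indicator 1 x - h x| ∂ν := by
    have hBint : Integrable (B.indicator (1 : ℝ → ℝ)) ν := (integrable_const 1).indicator hB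
    have hhint : Integrable h ν := Integrable.of_bound hc.aestronglyMeasurable 1
      (ae_of_all _ fun x => by rw [Real.norm_eq_abs, abs_of_nonneg (h0 x)]; exact h1 x)
    refine ⟨(hBint.sub hhint).abs, ?_⟩
    rw [← integral_indicator_one hB, ← integral_sub hBint hhint]
    exact abs_integral_le_integral_abs
  obtain ⟨hμi, hμ⟩ := hclose μ
  obtain ⟨hγi, hγ⟩ := hclose γ
  rw [integral_add_measure hμi hγi] at happrox
  have hμB : (ℙ (F ⁻¹' B)).toReal = μ.real B := by
    rw [measureReal_def, Measure.map_apply hFmeas hB]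
  rw [hμB]
  change |μ.real B - γ.real B| ≤ _
  have hmain := abs_le.1 (hcont hc h0 h1)
  have hμ := abs_le.1 hμ
  have hγ := abs_le.1 hγ
  exact abs_le.2 ⟨by linarith, by linarith⟩
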